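/- Every subflame of a rooted digraph D = (V+r, E) is contained in a maximal flame of D; in particular (taking the empty subflame), every rooted digraph D has a spanning subgraph F with λ_D(r,v) = λ_F(r,v) = ϱ_F(v) for every v ∈ V. -/

import Mathlib

/- Common setup: a rooted digraph `D = (V+r, E)` is modelled as a finite
vertex type `α` (whose elements are `V ∪ {r}`), a finite edge type `E`
(allowing parallel edges, i.e. a multigraph) and maps `tail head : E → α`.
Subgraphs / edge subsets are sets `F : Set E`; the whole digraph `D`
corresponds to the edge set `Set.univ`.  "`v ∈ V`" is rendered as `v ≠ r`,
and a vertex subset `X ⊆ V` as `X : Set α` with `r ∉ X`. -/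

/-- In-degree of the vertex `v` in the digraph with edge set `F`. -/
noncomputable def inDeg {α E : Type*} (head : E → α) (F : Set E) (v : α) : ℕ :=
  {e ∈ F | head e = v}.ncard

/-- `ϱ_F(X)`: the number of edges of `F` entering the vertex set `X`
(tail outside `X`, head in `X`). -/
noncomputable def rho {α E : Type*} (tail head : E → α) (F : Set E) (X : Set α) : ℕ :=
  {e ∈ F | tail e ∉ X ∧ head e ∈ X}.ncard

/-- `p` is a directed path from `r` to `v` using edges of `F`:
a nonempty list of consecutive edges, starting at `r`, ending at `v`, and
visiting pairwise distinct vertices. -/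
def IsRVPath {α E : Type*} (tail head : E → α) (F : Set E) (r v : α) (p : List E) : Prop :=
  (∀ e ∈ p, e ∈ F) ∧
  List.Chain' (fun e f => head e = tail f) p ∧
  (p.map tail).Nodup ∧ (∀ e ∈ p, tail e ≠ v) ∧
  (∃ e, p.head? = some e ∧ tail e = r) ∧
  (∃ e, p.getLast? = some e ∧ head e = v)

/-- There exist `n` pairwise edge-disjoint directed paths from `r` to `v`
in the edge set `F`. -/
def HasEDPaths {α E : Type*} (tail head : E → α) (F : Set E) (r v : α) (n : ℕ) : Prop :=
  ∃ P : Fin n → List E, (∀ i, IsRVPath tail head F r v (P i)) ∧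
    ∀ i j, i ≠ j → ∀ e, e ∈ P i → e ∉ P j

/-- `λ_F(r,v)`: the local edge-connectivity from `r` to `v`, i.e. the maximum
number of pairwise edge-disjoint directed paths from `r` to `v` in `F`. -/
noncomputable def lam {α E : Type*} (tail head : E → α) (F : Set E) (r v : α) : ℕ :=
  sSup {n | HasEDPaths tail head F r v n}

/-- `X` is a `v`-tight vertex set in the digraph with edge set `F` and root `r`:
`X ⊆ V` (i.e. `r ∉ X`), `v ∈ X` and `ϱ_F(X) = λ_F(r,v)`. -/
def Tight {α E : Type*} (tail head : E → α) (F : Set E) (r v : α) (X : Set α) : Prop :=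
  v ∈ X ∧ r ∉ X ∧ rho tail head F X = lam tail head F r v

/-- The digraph with edge set `F` is a flame with root `r`:
`λ_F(r,v) = ϱ_F(v)` for every `v ∈ V`. -/
def IsFlame {α E : Type*} (tail head : E → α) (F : Set E) (r : α) : Prop :=
  ∀ v, v ≠ r → lam tail head F r v = inDeg head F v

/-- `F` is a maximal flame within the ambient edge set `A`:
`λ_A(r,v) = λ_F(r,v) = ϱ_F(v)` for every `v ∈ V`. -/
def IsMaxFlameIn {α E : Type*} (tail head : E → α) (A : Set E) (r : α) (F : Set E) : Prop :=
  F ⊆ A ∧ ∀ v, v ≠ r →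
    lam tail head A r v = lam tail head F r v ∧
    lam tail head F r v = inDeg head F v

/-- A closed directed walk in `F` with pairwise distinct edges.  (If every
vertex is entered by at most one edge of `F`, the existence of such a walk is
equivalent to the existence of an undirected cycle in `F`.) -/
def IsDicycle {α E : Type*} (tail head : E → α) (F : Set E) (p : List E) : Prop :=
  p.Nodup ∧ (∀ e ∈ p, e ∈ F) ∧
  List.Chain' (fun e f => head e = tail f) p ∧
  (∃ e f, p.head? = some e ∧ p.getLast? = some f ∧ head f = tail e)

/-- `B` is a branching: every vertex is entered by at most one edge of `B` and,
disregarding edge directions, `B` contains no cycle (under the in-degree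
condition this is equivalent to containing no directed cycle). -/
def IsBranching {α E : Type*} (tail head : E → α) (B : Set E) : Prop :=
  (∀ v, inDeg head B v ≤ 1) ∧ ∀ p : List E, ¬ IsDicycle tail head B p

/-- The head-set of an edge set `B`: the vertices entered by an edge of `B`. -/
def headSet {α E : Type*} (head : E → α) (B : Set E) : Set α := {v | ∃ e ∈ B, head e = v}

/-- Independence in the gammoid `G_D(v)` (with `D` the whole digraph, edge set
`Set.univ`): `X ⊆ in_D(v)` is independent if there are `|X|` pairwise
edge-disjoint directed paths from `r` to `v` in `D` whose set of last edges is
exactly `X`. -/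
def GammoidIndep {α E : Type*} (tail head : E → α) (r v : α) (X : Set E) : Prop :=
  ∃ P : Fin X.ncard → List E,
    (∀ i, IsRVPath tail head Set.univ r v (P i)) ∧
    (∀ i j, i ≠ j → ∀ e, e ∈ P i → e ∉ P j) ∧
    (∀ e, e ∈ X ↔ ∃ i, (P i).getLast? = some e)

section Menger

variable {α E : Type*} {tail head : E → α}

/-- Deleting an edge that does not enter `X` does not change `ϱ(X)`. -/
theorem rho_diff_singleton {F : Set E} {X : Set α} {e : E} (h : tail e ∈ X ∨ head e ∉ X) :
    rho tail head (F \ {e}) X = rho tail head F X := by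
  unfold rho
  congr 1
  ext f
  simp only [Set.mem_ofPred_eq, Set.mem_sdiff, Set.mem_singleton_iff]
  constructor
  · tauto
  · rintro ⟨hf, ht, hh⟩
    refine ⟨⟨hf, ?_⟩, ht, hh⟩
    rintro rfl
    tauto

theorem exists_entering_of_isChain {X : Set α} {v : α} (hv : v ∈ X) (p : List E)
    (hp : List.IsChain (fun e f => head e = tail f) p)
    (hh : ∃ e, p.head? = some e ∧ tail e ∉ X) (hl : ∃ e, p.getLast? = some e ∧ head e = v) :
    ∃ e ∈ p, tail e ∉ X ∧ head e ∈ X := by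
  induction p with
  | nil => simp at hh
  | cons a p ih =>
    have ha : tail a ∉ X := by simpa using hh
    by_cases haX : head a ∈ X
    · exact ⟨a, by simp, ha, haX⟩
    cases p with
    | nil =>
      have : head a = v := by simpa using hl
      exact absurd (this ▸ hv) haX
    | cons b q =>
      rw [List.isChain_cons_cons] at hp
      obtain ⟨e, he, h⟩ := ih hp.2 ⟨b, rfl, hp.1 ▸ haX⟩ (by simpa using hl)
      exact ⟨e, List.mem_cons_of_mem _ he, h⟩

/-- Reachability within an edge set is witnessed by a directed path. -/
theorem exists_isRVPath_of_reflTransGen {Q : Set E} {a v : α}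
    (h : Relation.ReflTransGen (fun x y => ∃ e ∈ Q, tail e = x ∧ head e = y) a v) (hav : a ≠ v) :
    ∃ p, IsRVPath tail head Q a v p := by
  induction h using Relation.ReflTransGen.head_induction_on with
  | refl => exact absurd rfl hav
  | head h _ ih =>
    obtain ⟨e, heQ, rfl, rfl⟩ := h
    by_cases hb : head e = v
    · exact ⟨[e], by simpa using heQ, List.isChain_singleton _, by simp, by simpa using hav,
        ⟨e, rfl, rfl⟩, ⟨e, rfl, hb⟩⟩
    obtain ⟨p, hpQ, hc, hnd, htv, ⟨b, hb, hbt⟩, ⟨l, hl, hlv⟩⟩ := ih hb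
    by_cases hmem : tail e ∈ p.map tail
    · obtain ⟨f, hf, hfe⟩ := List.mem_map.1 hmem
      obtain ⟨s, t, rfl⟩ := List.append_of_mem hf
      refine ⟨f :: t, fun x hx => hpQ x (List.mem_append_right _ hx),
        hc.suffix (List.suffix_append _ _), ?_, fun x hx => htv x (List.mem_append_right _ hx),
        ⟨f, rfl, hfe⟩, ⟨l, ?_, hlv⟩⟩
      · rw [List.map_append] at hnd
        exact hnd.of_append_right
      · rwa [List.getLast?_append_of_ne_nil _ (by simp)] at hl
    · cases p with
      | nil => simp at hb
      | cons c q =>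
        obtain rfl : c = b := by simpa using hb
        refine ⟨e :: c :: q, ?_, List.isChain_cons_cons.2 ⟨hbt.symm, hc⟩, ?_, ?_,
          ⟨e, rfl, rfl⟩, ⟨l, by simpa using hl, hlv⟩⟩
        · exact List.forall_mem_cons.2 ⟨heQ, hpQ⟩
        · rw [List.map_cons, List.nodup_cons]
          exact ⟨hmem, hnd⟩
        · exact List.forall_mem_cons.2 ⟨hav, htv⟩

/-- The continuations of an edge or of one of `n` source tokens in a system of `n` edge-disjoint
paths from `r` to `v`: the next edge, one of `n` sink tokens after an edge into `v`, or the edge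
itself when it is unused. -/
def IsNext (tail head : E → α) (F : Set E) (r v : α) (n : ℕ) :
    E ⊕ Fin n → E ⊕ Fin n → Prop
  | .inl e, .inl f => e = f ∨ (f ∈ F ∧ head e = tail f)
  | .inl e, .inr _ => head e = v
  | .inr _, .inl f => f ∈ F ∧ tail f = r
  | .inr _, .inr _ => False

variable [Finite E]

theorem rho_mono {F G : Set E} (h : F ⊆ G) (X : Set α) :
    rho tail head F X ≤ rho tail head G X :=
  Set.ncard_le_ncard fun _ he => ⟨h he.1, he.2⟩

theorem rho_submodular (F : Set E) (X Y : Set α) :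
    rho tail head F (X ∩ Y) + rho tail head F (X ∪ Y) ≤
      rho tail head F X + rho tail head F Y := by
  unfold rho
  rw [← Set.ncard_union_add_ncard_inter, ← Set.ncard_union_add_ncard_inter {e ∈ F | tail e ∉ X ∧ _}]
  refine add_le_add (Set.ncard_le_ncard ?_) (Set.ncard_le_ncard ?_)
  · intro e
    simp only [Set.mem_union, Set.mem_inter_iff, Set.mem_ofPred_eq]
    tauto
  · intro e
    simp only [Set.mem_union, Set.mem_inter_iff, Set.mem_ofPred_eq]
    tauto

theorem rho_le_rho_diff_singleton_add_one (F : Set E) (X : Set α) (e : E) :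
    rho tail head F X ≤ rho tail head (F \ {e}) X + 1 := by
  unfold rho
  have h : {f ∈ F \ {e} | tail f ∉ X ∧ head f ∈ X} = {f ∈ F | tail f ∉ X ∧ head f ∈ X} \ {e} := by
    ext f
    simp only [Set.mem_ofPred_eq, Set.mem_sdiff, Set.mem_singleton_iff]
    tauto
  rw [h]
  have := Set.le_ncard_sdiff {e} {f ∈ F | tail f ∉ X ∧ head f ∈ X}
  rw [Set.ncard_singleton] at this
  omega

theorem HasEDPaths.le_rho {F : Set E} {r v : α} {n : ℕ} (h : HasEDPaths tail head F r v n)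
    {X : Set α} (hv : v ∈ X) (hr : r ∉ X) : n ≤ rho tail head F X := by
  obtain ⟨P, hP, hd⟩ := h
  have key : ∀ i, ∃ e ∈ P i, tail e ∉ X ∧ head e ∈ X := fun i => by
    obtain ⟨-, hc, -, -, ⟨a, ha, har⟩, hl⟩ := hP i
    exact exists_entering_of_isChain hv _ hc ⟨a, ha, har ▸ hr⟩ hl
  choose c hc hcX using key
  have hinj : Function.Injective c := fun i j hij => by
    by_contra hne
    exact hd i j hne _ (hc i) (hij ▸ hc j)
  have := Set.ncard_le_ncard (s := Set.range c) (t := {e ∈ F | tail e ∉ X ∧ head e ∈ X}) (by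
    rintro _ ⟨i, rfl⟩
    exact ⟨(hP i).1 _ (hc i), hcX i⟩)
  rwa [← Set.image_univ, Set.ncard_image_of_injective _ hinj, Set.ncard_univ, Nat.card_fin] at this

theorem exists_injective_isNext {F : Set E} {r v : α} (hrv : v ≠ r) {n : ℕ}
    (h : ∀ X : Set α, v ∈ X → r ∉ X → n ≤ rho tail head F X) :
    ∃ f : E ⊕ Fin n → E ⊕ Fin n, Function.Injective f ∧ ∀ x, IsNext tail head F r v n x (f x) := by
  classical
  have := Fintype.ofFinite E
  let N : E ⊕ Fin n → Finset (E ⊕ Fin n) := fun x => {y | IsNext tail head F r v n x y}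
  suffices hall : ∀ S : Finset (E ⊕ Fin n), S.card ≤ (S.biUnion N).card by
    obtain ⟨f, hf, hfN⟩ := (Finset.all_card_le_biUnion_card_iff_exists_injective N).1 hall
    exact ⟨f, hf, fun x => by simpa [N] using hfN x⟩
  have hN : ∀ {x y}, IsNext tail head F r v n x y → y ∈ N x := fun h =>
    Finset.mem_filter.2 ⟨Finset.mem_univ _, h⟩
  intro S
  have hself : ∀ e, Sum.inl e ∈ S → Sum.inl e ∈ S.biUnion N := fun e he =>
    Finset.mem_biUnion.2 ⟨_, he, hN (.inl rfl)⟩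
  have hcard : S.card = S.toLeft.card + S.toRight.card := (Finset.card_toLeft_add_card_toRight).symm
  have hcardN : (S.biUnion N).card = (S.biUnion N).toLeft.card + (S.biUnion N).toRight.card :=
    (Finset.card_toLeft_add_card_toRight).symm
  have hleft : S.toLeft ⊆ (S.biUnion N).toLeft := fun e he => by
    rw [Finset.mem_toLeft] at he ⊢
    exact hself e he
  have hSn : S.toRight.card ≤ n := by simpa using Finset.card_le_univ S.toRight
  rcases S.toRight.eq_empty_or_nonempty with h0 | ⟨i, hi⟩
  · have := Finset.card_le_card hleft
    rw [hcard, hcardN, h0, Finset.card_empty]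
    omega
  rw [Finset.mem_toRight] at hi
  by_cases hv : ∃ e ∈ S.toLeft, head e = v
  · obtain ⟨e, he, hev⟩ := hv
    rw [Finset.mem_toLeft] at he
    have huniv : (S.biUnion N).toRight = Finset.univ := by
      ext j
      simp only [Finset.mem_toRight, Finset.mem_univ, iff_true]
      exact Finset.mem_biUnion.2 ⟨_, he, hN hev⟩
    have := Finset.card_le_card hleft
    rw [hcard, hcardN, huniv, Finset.card_univ, Fintype.card_fin]
    omega
  · push Not at hv
    -- `X` consists of the vertices not reached by the edges of `S`.
    let X : Set α := {x | x ≠ r ∧ ∀ e ∈ S.toLeft, head e ≠ x}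
    have hX := h X ⟨hrv, hv⟩ (fun h => h.1 rfl)
    let C : Finset E := {e | e ∈ F ∧ tail e ∉ X ∧ head e ∈ X}
    have hC : rho tail head F X = C.card := by
      rw [rho, ← Set.ncard_coe_finset]
      congr 1
      ext e
      simp [C]
    have hdisj : Disjoint S.toLeft C := Finset.disjoint_left.2 fun e he heC =>
      (Finset.mem_filter.1 heC).2.2.2.2 e he rfl
    have hCN : C ⊆ (S.biUnion N).toLeft := fun f hf => by
      obtain ⟨hfF, hft, -⟩ := (Finset.mem_filter.1 hf).2
      rw [Finset.mem_toLeft, Finset.mem_biUnion]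
      by_cases hfr : tail f = r
      · exact ⟨_, hi, hN ⟨hfF, hfr⟩⟩
      · have : ∃ e ∈ S.toLeft, head e = tail f := by
          by_contra! hne
          exact hft ⟨hfr, hne⟩
        obtain ⟨e, he, hef⟩ := this
        exact ⟨_, Finset.mem_toLeft.1 he, hN (.inr ⟨hfF, hef⟩)⟩
    have := Finset.card_le_card (Finset.union_subset hleft hCN)
    rw [Finset.card_union_of_disjoint hdisj] at this
    omega

/-- Menger's theorem: if every cut has at least `n` edges, there are `n` edge-disjoint paths. -/
theorem hasEDPaths_of_le_rho {F : Set E} {r v : α} (hrv : v ≠ r) {n : ℕ}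
    (h : ∀ X : Set α, v ∈ X → r ∉ X → n ≤ rho tail head F X) :
    HasEDPaths tail head F r v n := by
  obtain ⟨f, hf, hnext⟩ := exists_injective_isNext hrv h
  let step : E → E → Prop := fun a b => f (.inl a) = .inl b
  let Q : Fin n → Set E :=
    fun i => {e | ∃ e₀, f (.inr i) = .inl e₀ ∧ Relation.ReflTransGen step e₀ e}
  have hQstep : ∀ i a b, a ∈ Q i → step a b → b ∈ Q i := by
    rintro i a b ⟨e₀, h₀, ha⟩ hab
    exact ⟨e₀, h₀, ha.tail hab⟩
  have hQdisj : ∀ i j e, e ∈ Q i → e ∈ Q j → i = j := by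
    rintro i j e ⟨a, hia, hae⟩ hj
    induction hae with
    | refl =>
      obtain ⟨b, hjb, hba⟩ := hj
      rcases hba.cases_tail with rfl | ⟨c, -, hc⟩
      · simpa using hf (hia.trans hjb.symm)
      · simpa using hf (hia.trans (Eq.symm hc))
    | tail _ hst ih =>
      obtain ⟨b, hjb, hbe⟩ := hj
      rcases hbe.cases_tail with rfl | ⟨c, hbc, hc⟩
      · simpa using hf (hjb.trans (Eq.symm hst))
      · obtain rfl := Sum.inl.inj (hf (Eq.trans hst (Eq.symm hc)))
        exact ih ⟨b, hjb, hbc⟩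
  have hreach : ∀ i, ∀ e ∈ Q i, e ∈ F ∧ Relation.ReflTransGen
      (fun x y => ∃ e ∈ Q i ∩ F, tail e = x ∧ head e = y) r (head e) := by
    rintro i e ⟨a, hia, hae⟩
    induction hae with
    | refl =>
      have hn := hnext (.inr i)
      rw [hia] at hn
      exact ⟨hn.1, .single ⟨a, ⟨⟨a, hia, .refl⟩, hn.1⟩, hn.2, rfl⟩⟩
    | @tail b c hab hbc ih =>
      have hn := hnext (.inl b)
      rw [show f (.inl b) = .inl c from hbc] at hn
      rcases hn with rfl | ⟨hcF, hbt⟩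
      · exact ih
      · exact ⟨hcF, ih.2.tail ⟨c, ⟨⟨a, hia, hab.tail hbc⟩, hcF⟩, hbt.symm, rfl⟩⟩
  have hend : ∀ i, ∃ e ∈ Q i, head e = v := by
    intro i
    by_contra! hne
    have hmaps : ∀ x ∈ insert (Sum.inr i) (Sum.inl '' Q i), f x ∈ Sum.inl '' Q i := by
      rintro x (rfl | ⟨e, he, rfl⟩)
      · have hn := hnext (.inr i)
        rcases hx : f (.inr i) with a | j
        · exact ⟨a, ⟨a, hx, .refl⟩, rfl⟩
        · rw [hx] at hn
          exact hn.elim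
      · have hn := hnext (.inl e)
        rcases hx : f (.inl e) with a | j
        · exact ⟨a, hQstep i e a he hx, rfl⟩
        · rw [hx] at hn
          exact absurd hn (hne e he)
    have hcard := Set.ncard_le_ncard_of_injOn f hmaps hf.injOn
    rw [Set.ncard_insert_of_notMem (by simp)] at hcard
    omega
  have hpath : ∀ i, ∃ p, IsRVPath tail head (Q i ∩ F) r v p := by
    intro i
    obtain ⟨e, he, rfl⟩ := hend i
    exact exists_isRVPath_of_reflTransGen (hreach i e he).2 hrv.symm
  choose P hP using hpath
  exact ⟨P, fun i => ⟨fun e he => ((hP i).1 e he).2, (hP i).2⟩,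
    fun i j hij e hi hj => hij (hQdisj i j e ((hP i).1 e hi).1 ((hP j).1 e hj).1)⟩

theorem lam_le_rho {F : Set E} {r v : α} {X : Set α} (hv : v ∈ X) (hr : r ∉ X) :
    lam tail head F r v ≤ rho tail head F X :=
  csSup_le' fun _ hn => hn.le_rho hv hr

theorem le_lam {F : Set E} {r v : α} (hrv : v ≠ r) {n : ℕ}
    (h : ∀ X : Set α, v ∈ X → r ∉ X → n ≤ rho tail head F X) :
    n ≤ lam tail head F r v :=
  le_csSup ⟨rho tail head F {v}, fun _ hm => hm.le_rho rfl hrv.symm⟩ (hasEDPaths_of_le_rho hrv h)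

theorem lam_mono {F G : Set E} (h : F ⊆ G) {r v : α} (hrv : v ≠ r) :
    lam tail head F r v ≤ lam tail head G r v :=
  le_lam hrv fun X hv hr => (lam_le_rho hv hr).trans (rho_mono h X)

theorem exists_tight (F : Set E) {r v : α} (hrv : v ≠ r) : ∃ X, Tight tail head F r v X := by
  by_contra! hne
  have := le_lam (n := lam tail head F r v + 1) hrv fun X hv hr =>
    lt_of_le_of_ne (lam_le_rho hv hr) fun heq => hne X ⟨hv, hr, heq.symm⟩
  omega

theorem lam_le_inDeg (F : Set E) {r v : α} (hrv : v ≠ r) :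
    lam tail head F r v ≤ inDeg head F v :=
  (lam_le_rho (X := {v}) rfl hrv.symm).trans (Set.ncard_le_ncard fun _ he => ⟨he.1, he.2.2⟩)

/-- If the edge `e` enters the vertex `v` from within an inclusion-minimal `v`-tight set,
deleting it preserves all local edge-connectivities from the root. -/
theorem lam_diff_singleton_of_minimal_tight {D : Set E} {r v : α} {T : Set α}
    (hT : Minimal (Tight tail head D r v) T) {e : E} (hev : head e = v) (heT : tail e ∈ T)
    {u : α} (hu : u ≠ r) : lam tail head (D \ {e}) r u = lam tail head D r u := by
  refine le_antisymm (lam_mono Set.sdiff_subset hu) (le_lam hu fun X huX hrX => ?_)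
  obtain ⟨hvT, hrT, hTtight⟩ := hT.prop
  by_cases heX : tail e ∈ X ∨ head e ∉ X
  · rw [rho_diff_singleton heX]
    exact lam_le_rho huX hrX
  push Not at heX
  have hinter : lam tail head D r v < rho tail head D (X ∩ T) := by
    have hvI : v ∈ X ∩ T := ⟨hev ▸ heX.2, hvT⟩
    have hrI : r ∉ X ∩ T := fun h => hrT h.2
    refine lt_of_le_of_ne (lam_le_rho hvI hrI) fun heq => heX.1 ?_
    exact (hT.le_of_le ⟨hvI, hrI, heq.symm⟩ Set.inter_subset_right heT).1
  have hdel := rho_le_rho_diff_singleton_add_one (tail := tail) (head := head) D (X ∩ T) e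
  have hsub := rho_submodular (tail := tail) (head := head) (D \ {e}) X T
  rw [rho_diff_singleton (X := T) (.inl heT), rho_diff_singleton (X := X ∪ T) (.inl (.inr heT))]
    at hsub
  have hunion : lam tail head D r u ≤ rho tail head D (X ∪ T) :=
    lam_le_rho (.inl huX) fun h => h.elim hrX hrT
  omega

/-- If `D` extends a flame and some vertex is not saturated in `D`, then an edge outside the flame
can be deleted while preserving all local edge-connectivities from the root. -/
theorem IsFlame.exists_lam_diff_singleton [Finite α] {F₀ D : Set E} {r v : α}
    (hF₀ : IsFlame tail head F₀ r) (hF₀D : F₀ ⊆ D) (hrv : v ≠ r)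
    (hlt : lam tail head D r v < inDeg head D v) :
    ∃ e ∈ D \ F₀, ∀ u, u ≠ r → lam tail head (D \ {e}) r u = lam tail head D r u := by
  obtain ⟨T, hT⟩ := Set.Finite.exists_minimal (Set.toFinite {X | Tight tail head D r v X})
    (exists_tight D hrv)
  obtain ⟨hvT, hrT, hTtight⟩ := hT.prop
  suffices h : ∃ e ∈ D \ F₀, head e = v ∧ tail e ∈ T by
    obtain ⟨e, he, hev, heT⟩ := h
    exact ⟨e, he, fun u hu => lam_diff_singleton_of_minimal_tight hT hev heT hu⟩
  by_contra! hne
  have h₁ : inDeg head D v ≤ inDeg head F₀ v + {e ∈ D \ F₀ | head e = v}.ncard := by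
    refine le_trans (Set.ncard_le_ncard fun e he => ?_) (Set.ncard_union_le _ _)
    by_cases heF : e ∈ F₀
    · exact .inl ⟨heF, he.2⟩
    · exact .inr ⟨⟨he.1, heF⟩, he.2⟩
  have h₂ : rho tail head F₀ T + {e ∈ D \ F₀ | head e = v}.ncard ≤ rho tail head D T := by
    unfold rho
    rw [← Set.ncard_union_eq (Set.disjoint_left.2 fun e he he' => he'.1.2 he.1)]
    refine Set.ncard_le_ncard ?_
    rintro e (he | he)
    · exact ⟨hF₀D he.1, he.2⟩
    · exact ⟨he.1.1, hne e he.1 he.2, he.2 ▸ hvT⟩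
  have h₃ : inDeg head F₀ v ≤ rho tail head F₀ T := hF₀ v hrv ▸ lam_le_rho hvT hrT
  omega

theorem IsFlame.exists_isMaxFlameIn_univ [Finite α] {F₀ : Set E} {r : α}
    (hF₀ : IsFlame tail head F₀ r) :
    ∃ F : Set E, F₀ ⊆ F ∧ IsMaxFlameIn tail head Set.univ r F := by
  obtain ⟨D, hD⟩ := Set.Finite.exists_minimal
    (Set.toFinite {D : Set E | F₀ ⊆ D ∧
      ∀ u, u ≠ r → lam tail head Set.univ r u = lam tail head D r u})
    ⟨Set.univ, Set.subset_univ _, fun _ _ => rfl⟩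
  obtain ⟨hF₀D, hlam⟩ := hD.prop
  refine ⟨D, hF₀D, Set.subset_univ _, fun v hv => ⟨hlam v hv, ?_⟩⟩
  by_contra hne
  obtain ⟨e, he, hlam'⟩ := hF₀.exists_lam_diff_singleton hF₀D hv
    (lt_of_le_of_ne (lam_le_inDeg D hv) hne)
  have hle := hD.le_of_le (y := D \ {e})
    ⟨fun f hf => ⟨hF₀D hf, fun hfe => he.2 (hfe ▸ hf)⟩,
      fun u hu => (hlam u hu).trans (hlam' u hu).symm⟩ Set.sdiff_subset
  exact (hle he.1).2 rfl

theorem isFlame_empty (r : α) : IsFlame tail head ∅ r := fun v hv => by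
  have := lam_le_inDeg (tail := tail) (head := head) ∅ hv
  have h0 : inDeg head ∅ v = 0 := by simp [inDeg]
  omega

end Menger

/-- every subflame of `D` is contained in a maximal flame of `D`;
in particular (taking the empty subflame), `D` has a spanning subgraph `F` with
`λ_D(r,v) = λ_F(r,v) = ϱ_F(v)` for every `v ∈ V`. -/
theorem subflame_le_maximal_flame
    {α E : Type*} [Fintype α] [Fintype E] (tail head : E → α) (r : α) :
    (∀ F₀ : Set E, IsFlame tail head F₀ r →
      ∃ F : Set E, F₀ ⊆ F ∧ IsMaxFlameIn tail head Set.univ r F) ∧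
    ∃ F : Set E, IsMaxFlameIn tail head Set.univ r F := by
  have key := fun F₀ (hF₀ : IsFlame tail head F₀ r) => IsFlame.exists_isMaxFlameIn_univ hF₀
  obtain ⟨F, -, hF⟩ := key ∅ (isFlame_empty r)
  exact ⟨key, F, hF⟩
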